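/- Let (G,X) be a self-similar action such that for every g ∈ G \ {e} the set {g|_v : v ∈ X*} is finite. Then for every g ≠ e, with G_g^k = {v ∈ X^k : g·v = v} and F_g^k = {v ∈ X^k : g·v = v, g|_v = e}, there exists j ≥ 1 such that |G_g^{nj} \ F_g^{nj}| ≤ (|X|^j − 1)^n for all n ≥ 1; consequently |X|^{-k}(|G_g^k| − |F_g^k|) → 0 along k = nj, and lim_k |X|^{-k}|G_g^k| = lim_k |X|^{-k}|F_g^k| = c_g. -/

import Mathlib

/-- A self-similar action of a group `G` on words over an alphabet `X`:
`act` is the (faithful) action on finite words, `actX` the induced action on letters,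
and `res` the restriction map, satisfying `g · (x w) = (g · x)(g|ₓ · w)`. -/
structure SelfSimilarAction (G : Type*) (X : Type*) [Group G] where
  act : G → List X → List X
  actX : G → X → X
  res : G → X → G
  act_nil : ∀ g, act g [] = []
  act_cons : ∀ g x w, act g (x :: w) = actX g x :: act (res g x) w
  one_act : ∀ w, act 1 w = w
  mul_act : ∀ g h w, act (g * h) w = act g (act h w)
  faithful : ∀ g h : G, (∀ w, act g w = act h w) → g = h

namespace SelfSimilarAction

variable {G X : Type*} [Group G]

/-- The restriction of `g` to a word, `g|_v`. -/
def resW (S : SelfSimilarAction G X) : G → List X → G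
  | g, [] => g
  | g, x :: v => S.resW (S.res g x) v

end SelfSimilarAction

open Filter
section Helpers
open Classical

variable {G X : Type*} [Group G]

theorem ssa_length (S : SelfSimilarAction G X) (g : G) (w : List X) :
    (S.act g w).length = w.length := by
  induction w generalizing g with
  | nil => simp [S.act_nil]
  | cons x w ih => simp [S.act_cons, ih]

theorem ssa_append (S : SelfSimilarAction G X) (g : G) (u w : List X) :
    S.act g (u ++ w) = S.act g u ++ S.act (S.resW g u) w := by
  induction u generalizing g with
  | nil => simp [S.act_nil, SelfSimilarAction.resW]
  | cons x u ih => simp [S.act_cons, ih, SelfSimilarAction.resW]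

theorem ssa_resW_append (S : SelfSimilarAction G X) (g : G) (u w : List X) :
    S.resW g (u ++ w) = S.resW (S.resW g u) w := by
  induction u generalizing g with
  | nil => simp [SelfSimilarAction.resW]
  | cons x u ih => simp [ih, SelfSimilarAction.resW]

theorem ssa_fix_append (S : SelfSimilarAction G X) (g : G) (u w : List X) :
    S.act g (u ++ w) = u ++ w ↔ S.act g u = u ∧ S.act (S.resW g u) w = w := by
  rw [ssa_append]
  constructor
  · intro h
    exact List.append_inj h (ssa_length S g u)
  · rintro ⟨h1, h2⟩
    rw [h1, h2]

theorem ssa_res_one (S : SelfSimilarAction G X) (x : X) : S.res 1 x = 1 := by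
  apply S.faithful
  intro w
  have h := S.one_act (x :: w)
  rw [S.act_cons] at h
  rw [S.one_act]
  exact (List.cons.inj h).2

theorem ssa_resW_one (S : SelfSimilarAction G X) (w : List X) : S.resW 1 w = 1 := by
  induction w with
  | nil => rfl
  | cons x w ih => simp [SelfSimilarAction.resW, ssa_res_one, ih]

variable [Fintype X]

/-- Words of length `k`. -/
noncomputable def ssaW (X : Type*) [Fintype X] (k : ℕ) : Finset (List X) :=
  (List.finite_length_eq X k).toFinset

theorem mem_ssaW (k : ℕ) (v : List X) : v ∈ ssaW X k ↔ v.length = k := by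
  simp [ssaW]

theorem ssa_natCard (k : ℕ) (P : List X → Prop) [DecidablePred P] :
    Nat.card {v : List X // v.length = k ∧ P v} = ((ssaW X k).filter P).card := by
  apply Nat.subtype_card
  intro v
  simp [mem_ssaW]

theorem card_ssaW (k : ℕ) : (ssaW X k).card = Fintype.card X ^ k := by
  rw [← card_vector (α := X) k, ← Nat.card_eq_fintype_card]
  symm
  apply Nat.subtype_card
  intro v
  exact mem_ssaW k v

/-- Fixed words with nontrivial restriction. -/
noncomputable def ssaD (S : SelfSimilarAction G X) (g : G) (k : ℕ) : Finset (List X) :=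
  (ssaW X k).filter (fun v => S.act g v = v ∧ S.resW g v ≠ 1)

/-- Fixed words with trivial restriction. -/
noncomputable def ssaF (S : SelfSimilarAction G X) (g : G) (k : ℕ) : Finset (List X) :=
  (ssaW X k).filter (fun v => S.act g v = v ∧ S.resW g v = 1)

theorem ssaG_card (S : SelfSimilarAction G X) (g : G) (k : ℕ) :
    ((ssaW X k).filter (fun v => S.act g v = v)).card
      = (ssaF S g k).card + (ssaD S g k).card := by
  rw [← Finset.card_filter_add_card_filter_not (s := (ssaW X k).filter (fun v => S.act g v = v))
    (fun v => S.resW g v = 1), Finset.filter_filter, Finset.filter_filter]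
  rfl

theorem ssaD_step (S : SelfSimilarAction G X) (g : G) (k j B : ℕ)
    (hB : ∀ u, S.resW g u ≠ 1 →
      ((ssaW X j).filter (fun w => S.act (S.resW g u) w = w)).card ≤ B) :
    (ssaD S g (k + j)).card ≤ (ssaD S g k).card * B := by
  have hsub : ssaD S g (k + j) ⊆ (ssaD S g k).biUnion (fun u =>
      ((ssaW X j).filter (fun w => S.act (S.resW g u) w = w)).image (fun w => u ++ w)) := by
    intro v hv
    simp only [ssaD, Finset.mem_filter, mem_ssaW] at hv
    obtain ⟨hl, hf, hr⟩ := hv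
    have hv : v.take k ++ v.drop k = v := List.take_append_drop k v
    rw [← hv, ssa_fix_append] at hf
    rw [← hv, ssa_resW_append] at hr
    simp only [ssaD, Finset.mem_biUnion, Finset.mem_image, Finset.mem_filter, mem_ssaW]
    refine ⟨v.take k, ⟨by simp; omega, hf.1, ?_⟩, v.drop k, ⟨by simp; omega, hf.2⟩, hv⟩
    intro h
    rw [h, ssa_resW_one] at hr
    exact hr rfl
  refine (Finset.card_le_card hsub).trans (Finset.card_biUnion_le_card_mul _ _ _ ?_)
  intro u hu
  simp only [ssaD, Finset.mem_filter] at hu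
  exact Finset.card_image_le.trans (hB u hu.2.2)

theorem ssaF_step (S : SelfSimilarAction G X) (g : G) (k : ℕ) :
    (ssaF S g k).card * Fintype.card X ≤ (ssaF S g (k + 1)).card := by
  rw [← Finset.card_univ, ← Finset.card_product]
  apply Finset.card_le_card_of_injOn (fun p => p.1 ++ [p.2])
  · rintro ⟨u, x⟩ h
    simp only [ssaF, Finset.coe_product, Set.mem_prod, Finset.mem_coe, Finset.mem_filter,
      mem_ssaW] at h ⊢
    obtain ⟨⟨h1, h2, h3⟩, -⟩ := h
    refine ⟨by simp [h1], ?_, ?_⟩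
    · rw [ssa_fix_append, h3, S.one_act]
      exact ⟨h2, rfl⟩
    · rw [ssa_resW_append, h3, ssa_resW_one]
  · rintro ⟨u, x⟩ - ⟨v, y⟩ - h
    simp only at h
    have := List.append_inj' h rfl
    simp_all

theorem ssa_exists_j (S : SelfSimilarAction G X) (g : G) [Nonempty X]
    (hfin : {h : G | ∃ v : List X, S.resW g v = h}.Finite) :
    ∃ j : ℕ, 1 ≤ j ∧ ∀ u, S.resW g u ≠ 1 → ∃ w : List X, w.length = j ∧
      S.act (S.resW g u) w ≠ w := by
  have hex : ∀ h : G, ∃ w : List X, h ≠ 1 → S.act h w ≠ w := by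
    intro h
    by_cases h1 : h = 1
    · exact ⟨[], fun hh => absurd h1 hh⟩
    · by_contra! hc
      apply h1
      apply S.faithful
      intro w
      rw [S.one_act]
      exact (hc w).2
  choose f hf using hex
  obtain ⟨M, hM⟩ := (hfin.image (fun h => (f h).length)).bddAbove
  refine ⟨M + 1, by omega, fun u hu => ?_⟩
  have hle : (f (S.resW g u)).length ≤ M := hM ⟨_, ⟨u, rfl⟩, rfl⟩
  obtain ⟨x⟩ := ‹Nonempty X›
  refine ⟨f (S.resW g u) ++ List.replicate (M + 1 - (f (S.resW g u)).length) x, ?_, ?_⟩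
  · simp; omega
  · rw [Ne, ssa_fix_append]
    exact fun h => hf _ hu h.1

end Helpers



/-- If every `g ≠ e` has finite restriction set `{g|_v : v ∈ X*}`, then for every
`g ≠ e` there exists `j ≥ 1` with `|G_g^{nj} \ F_g^{nj}| ≤ (|X|^j − 1)^n` for all
`n ≥ 1`; consequently `|X|^{-nj}(|G_g^{nj}| − |F_g^{nj}|) → 0`, and
`|X|^{-k}|G_g^k|` and `|X|^{-k}|F_g^k|` converge to the same limit `c_g`. -/
theorem finite_restrictions_Ggk_Fgk {G X : Type*} [Group G] [Fintype X]
    (S : SelfSimilarAction G X)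
    (hfin : ∀ g : G, g ≠ 1 → {h : G | ∃ v : List X, S.resW g v = h}.Finite)
    (g : G) (hg : g ≠ 1) :
    ∃ j : ℕ, 1 ≤ j ∧
      (∀ n : ℕ, 1 ≤ n →
        Nat.card {v : List X // v.length = n * j ∧ S.act g v = v}
            - Nat.card {v : List X // v.length = n * j ∧ S.act g v = v ∧ S.resW g v = 1}
          ≤ (Fintype.card X ^ j - 1) ^ n) ∧
      Tendsto (fun n : ℕ =>
        ((Nat.card {v : List X // v.length = n * j ∧ S.act g v = v} : ℝ)
            - (Nat.card {v : List X // v.length = n * j ∧ S.act g v = v ∧ S.resW g v = 1} : ℝ))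
          / (Fintype.card X : ℝ) ^ (n * j)) atTop (nhds 0) ∧
      ∃ c : ℝ,
        Tendsto (fun k : ℕ =>
          (Nat.card {v : List X // v.length = k ∧ S.act g v = v ∧ S.resW g v = 1} : ℝ)
            / (Fintype.card X : ℝ) ^ k) atTop (nhds c) ∧
        Tendsto (fun k : ℕ =>
          (Nat.card {v : List X // v.length = k ∧ S.act g v = v} : ℝ)
            / (Fintype.card X : ℝ) ^ k) atTop (nhds c) := by
  classical
  have hX : Nonempty X := by
    by_contra hX
    rw [not_nonempty_iff] at hX
    apply hg
    apply S.faithful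
    intro w
    rw [S.one_act, List.eq_nil_of_length_eq_zero (l := w) ?_, S.act_nil]
    cases w with
    | nil => rfl
    | cons x w => exact (hX.false x).elim
  have hq : 0 < Fintype.card X := Fintype.card_pos
  have hqR : (0 : ℝ) < Fintype.card X := by exact_mod_cast hq
  obtain ⟨j, hj, hmove⟩ := ssa_exists_j S g (hfin g hg)
  have hGc : ∀ k, Nat.card {v : List X // v.length = k ∧ S.act g v = v}
      = (ssaF S g k).card + (ssaD S g k).card := by
    intro k
    rw [ssa_natCard k (fun v => S.act g v = v), ← ssaG_card]
  have hFc : ∀ k, Nat.card {v : List X // v.length = k ∧ S.act g v = v ∧ S.resW g v = 1}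
      = (ssaF S g k).card := by
    intro k
    rw [ssa_natCard k (fun v => S.act g v = v ∧ S.resW g v = 1)]
    unfold ssaF
    congr!
  simp only [hGc, hFc]
  have hbound : ∀ n, (ssaD S g (n * j)).card ≤ (Fintype.card X ^ j - 1) ^ n := by
    intro n
    induction n with
    | zero =>
      have h : (ssaD S g (0 * j)).card ≤ (ssaW X (0 * j)).card :=
        Finset.card_le_card (Finset.filter_subset _ _)
      rw [card_ssaW] at h
      simpa using h
    | succ n ih =>
      rw [Nat.succ_mul, pow_succ]
      refine (ssaD_step S g (n * j) j _ ?_).trans (Nat.mul_le_mul_right _ ih)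
      intro u hu
      obtain ⟨w, hw, hne⟩ := hmove u hu
      apply Nat.le_sub_one_of_lt
      rw [← card_ssaW]
      apply Finset.card_lt_card
      rw [Finset.filter_ssubset]
      exact ⟨w, (mem_ssaW j w).2 hw, hne⟩
  have hD0 : Tendsto (fun n : ℕ => ((ssaD S g (n * j)).card : ℝ)
      / (Fintype.card X : ℝ) ^ (n * j)) atTop (nhds 0) := by
    have hpos : (0 : ℝ) < (Fintype.card X : ℝ) ^ j := pow_pos hqR j
    have hone : 1 ≤ Fintype.card X ^ j := Nat.one_le_pow _ _ hq
    have hcast : ((Fintype.card X ^ j - 1 : ℕ) : ℝ) = (Fintype.card X : ℝ) ^ j - 1 := by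
      push_cast [Nat.cast_sub hone]
      rfl
    have hr0 : (0 : ℝ) ≤ ((Fintype.card X ^ j - 1 : ℕ) : ℝ) / (Fintype.card X : ℝ) ^ j := by
      positivity
    have hr1 : ((Fintype.card X ^ j - 1 : ℕ) : ℝ) / (Fintype.card X : ℝ) ^ j < 1 := by
      rw [div_lt_one hpos, hcast]
      linarith
    refine squeeze_zero (fun n => by positivity) (fun n => ?_)
      (tendsto_pow_atTop_nhds_zero_of_lt_one hr0 hr1)
    rw [div_pow, ← pow_mul, mul_comm j n]
    gcongr
    exact_mod_cast hbound n
  have hDanti : Antitone (fun k : ℕ => ((ssaD S g k).card : ℝ) / (Fintype.card X : ℝ) ^ k) := by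
    apply antitone_nat_of_succ_le
    intro k
    have h := ssaD_step S g k 1 (Fintype.card X) (fun u _ => by
      refine (Finset.card_le_card (Finset.filter_subset _ _)).trans ?_
      rw [card_ssaW, pow_one])
    have h' : ((ssaD S g (k + 1)).card : ℝ) ≤ (ssaD S g k).card * Fintype.card X := by
      exact_mod_cast h
    rw [div_le_div_iff₀ (by positivity) (by positivity), pow_succ]
    calc _ ≤ ((ssaD S g k).card * Fintype.card X : ℝ) * (Fintype.card X : ℝ) ^ k := by gcongr
      _ = _ := by ring
  have hFmono : Monotone (fun k : ℕ => ((ssaF S g k).card : ℝ) / (Fintype.card X : ℝ) ^ k) := by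
    apply monotone_nat_of_le_succ
    intro k
    have h' : ((ssaF S g k).card : ℝ) * Fintype.card X ≤ (ssaF S g (k + 1)).card := by
      exact_mod_cast ssaF_step S g k
    rw [div_le_div_iff₀ (by positivity) (by positivity), pow_succ]
    calc _ = ((ssaF S g k).card * Fintype.card X : ℝ) * (Fintype.card X : ℝ) ^ k := by ring
      _ ≤ _ := by gcongr
  have hDlim : Tendsto (fun k : ℕ => ((ssaD S g k).card : ℝ) / (Fintype.card X : ℝ) ^ k)
      atTop (nhds 0) := by
    have h1 := tendsto_atTop_ciInf hDanti ⟨0, by rintro _ ⟨k, rfl⟩; positivity⟩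
    have hsub : Tendsto (fun n : ℕ => n * j) atTop atTop :=
      tendsto_id.atTop_mul_const' (by omega)
    have h2 := tendsto_nhds_unique (h1.comp hsub) hD0
    rwa [h2] at h1
  have hFlim := tendsto_atTop_ciSup hFmono ⟨1, by
    rintro _ ⟨k, rfl⟩
    simp only
    rw [div_le_one (by positivity)]
    have h : (ssaF S g k).card ≤ (ssaW X k).card :=
      Finset.card_le_card (Finset.filter_subset _ _)
    rw [card_ssaW] at h
    exact_mod_cast h⟩
  refine ⟨j, hj, fun n _ => ?_, ?_, _, hFlim, ?_⟩
  · rw [Nat.add_sub_cancel_left]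
    exact hbound n
  · simpa using hD0
  · have h := hFlim.add hDlim
    rw [add_zero] at h
    refine h.congr (fun k => ?_)
    push_cast
    ring
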